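/- Let F = (V+r, E) be a flame with root r and ϱ_F(r) = 0. Let m = max_{v ∈ V} ϱ_F(v) ≥ 1 and V_i = {v ∈ V : ϱ_F(v) ≥ i} for i = 1, 2, …, m. Then E can be partitioned into pairwise disjoint branchings B₁, B₂, …, B_m such that the head-set of B_i is V_i and B₁ ∪ B₂ ∪ … ∪ B_i is a flame (as an edge set of a spanning subgraph of F) for every i = 1, 2, …, m. -/

import Mathlib

/- Common setup: a rooted digraph `D = (V+r, E)` is modelled as a finite
vertex type `α` (whose elements are `V ∪ {r}`), a finite edge type `E`
(allowing parallel edges, i.e. a multigraph) and maps `tail head : E → α`.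
Subgraphs / edge subsets are sets `F : Set E`; the whole digraph `D`
corresponds to the edge set `Set.univ`.  "`v ∈ V`" is rendered as `v ≠ r`,
and a vertex subset `X ⊆ V` as `X : Set α` with `r ∉ X`. -/

/-- In-degree of the vertex `v` in the digraph with edge set `F`. -/
noncomputable def inDeg {α E : Type*} (head : E → α) (F : Set E) (v : α) : ℕ :=
  {e ∈ F | head e = v}.ncard

/-- `ϱ_F(X)`: the number of edges of `F` entering the vertex set `X`
(tail outside `X`, head in `X`). -/
noncomputable def rho {α E : Type*} (tail head : E → α) (F : Set E) (X : Set α) : ℕ :=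
  {e ∈ F | tail e ∉ X ∧ head e ∈ X}.ncard

/-- `p` is a directed path from `r` to `v` using edges of `F`:
a nonempty list of consecutive edges, starting at `r`, ending at `v`, and
visiting pairwise distinct vertices. -/
def IsRVPath {α E : Type*} (tail head : E → α) (F : Set E) (r v : α) (p : List E) : Prop :=
  (∀ e ∈ p, e ∈ F) ∧
  List.Chain' (fun e f => head e = tail f) p ∧
  (p.map tail).Nodup ∧ (∀ e ∈ p, tail e ≠ v) ∧
  (∃ e, p.head? = some e ∧ tail e = r) ∧
  (∃ e, p.getLast? = some e ∧ head e = v)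

/-- There exist `n` pairwise edge-disjoint directed paths from `r` to `v`
in the edge set `F`. -/
def HasEDPaths {α E : Type*} (tail head : E → α) (F : Set E) (r v : α) (n : ℕ) : Prop :=
  ∃ P : Fin n → List E, (∀ i, IsRVPath tail head F r v (P i)) ∧
    ∀ i j, i ≠ j → ∀ e, e ∈ P i → e ∉ P j

/-- `λ_F(r,v)`: the local edge-connectivity from `r` to `v`, i.e. the maximum
number of pairwise edge-disjoint directed paths from `r` to `v` in `F`. -/
noncomputable def lam {α E : Type*} (tail head : E → α) (F : Set E) (r v : α) : ℕ :=
  sSup {n | HasEDPaths tail head F r v n}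

/-- `X` is a `v`-tight vertex set in the digraph with edge set `F` and root `r`:
`X ⊆ V` (i.e. `r ∉ X`), `v ∈ X` and `ϱ_F(X) = λ_F(r,v)`. -/
def Tight {α E : Type*} (tail head : E → α) (F : Set E) (r v : α) (X : Set α) : Prop :=
  v ∈ X ∧ r ∉ X ∧ rho tail head F X = lam tail head F r v

/-- The digraph with edge set `F` is a flame with root `r`:
`λ_F(r,v) = ϱ_F(v)` for every `v ∈ V`. -/
def IsFlame {α E : Type*} (tail head : E → α) (F : Set E) (r : α) : Prop :=
  ∀ v, v ≠ r → lam tail head F r v = inDeg head F v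

/-- `F` is a maximal flame within the ambient edge set `A`:
`λ_A(r,v) = λ_F(r,v) = ϱ_F(v)` for every `v ∈ V`. -/
def IsMaxFlameIn {α E : Type*} (tail head : E → α) (A : Set E) (r : α) (F : Set E) : Prop :=
  F ⊆ A ∧ ∀ v, v ≠ r →
    lam tail head A r v = lam tail head F r v ∧
    lam tail head F r v = inDeg head F v

/-- A closed directed walk in `F` with pairwise distinct edges.  (If every
vertex is entered by at most one edge of `F`, the existence of such a walk is
equivalent to the existence of an undirected cycle in `F`.) -/
def IsDicycle {α E : Type*} (tail head : E → α) (F : Set E) (p : List E) : Prop :=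
  p.Nodup ∧ (∀ e ∈ p, e ∈ F) ∧
  List.Chain' (fun e f => head e = tail f) p ∧
  (∃ e f, p.head? = some e ∧ p.getLast? = some f ∧ head f = tail e)

/-- `B` is a branching: every vertex is entered by at most one edge of `B` and,
disregarding edge directions, `B` contains no cycle (under the in-degree
condition this is equivalent to containing no directed cycle). -/
def IsBranching {α E : Type*} (tail head : E → α) (B : Set E) : Prop :=
  (∀ v, inDeg head B v ≤ 1) ∧ ∀ p : List E, ¬ IsDicycle tail head B p

/-- The head-set of an edge set `B`: the vertices entered by an edge of `B`. -/
def headSet {α E : Type*} (head : E → α) (B : Set E) : Set α := {v | ∃ e ∈ B, head e = v}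

/-- Independence in the gammoid `G_D(v)` (with `D` the whole digraph, edge set
`Set.univ`): `X ⊆ in_D(v)` is independent if there are `|X|` pairwise
edge-disjoint directed paths from `r` to `v` in `D` whose set of last edges is
exactly `X`. -/
def GammoidIndep {α E : Type*} (tail head : E → α) (r v : α) (X : Set E) : Prop :=
  ∃ P : Fin X.ncard → List E,
    (∀ i, IsRVPath tail head Set.univ r v (P i)) ∧
    (∀ i j, i ≠ j → ∀ e, e ∈ P i → e ∉ P j) ∧
    (∀ e, e ∈ X ↔ ∃ i, (P i).getLast? = some e)

theorem rho_eq_sum {α E : Type*} [Fintype E] (tail head : E → α) (F : Set E) (X : Set α) :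
    rho tail head F X =
      ∑ e : E, open Classical in if e ∈ F ∧ tail e ∉ X ∧ head e ∈ X then 1 else 0 := by
  classical
  rw [rho, Set.ncard_eq_toFinset_card', Finset.sum_boole]
  simp only [Nat.cast_id]
  congr 1
  ext e
  simp only [Set.mem_toFinset, Set.mem_ofPred_eq, Finset.mem_filter_univ]

theorem rho_inter_add_union_le {α E : Type*} [Fintype E] (tail head : E → α) (F : Set E)
    (X Y : Set α) :
    rho tail head F (X ∩ Y) + rho tail head F (X ∪ Y) ≤
      rho tail head F X + rho tail head F Y := by
  classical
  simp only [rho_eq_sum, ← Finset.sum_add_distrib]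
  refine Finset.sum_le_sum fun e _ => ?_
  by_cases h1 : e ∈ F <;> by_cases h2 : tail e ∈ X <;> by_cases h3 : tail e ∈ Y <;>
    by_cases h4 : head e ∈ X <;> by_cases h5 : head e ∈ Y <;> simp [h1, h2, h3, h4, h5]

theorem rho_le_rho {α E : Type*} [Fintype E] {tail head : E → α} {F G : Set E} {X Y : Set α}
    (h : ∀ e ∈ F, tail e ∉ X → head e ∈ X → e ∈ G ∧ tail e ∉ Y ∧ head e ∈ Y) :
    rho tail head F X ≤ rho tail head G Y :=
  Set.ncard_le_ncard (fun e he => h e he.1 he.2.1 he.2.2) (Set.toFinite _)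

theorem rho_le_rho_diff_singleton_add_one {α E : Type*} [Fintype E] (tail head : E → α)
    (F : Set E) (X : Set α) (e : E) :
    rho tail head F X ≤ rho tail head (F \ {e}) X + 1 := by
  unfold rho
  have h := Set.ncard_le_ncard_sdiff_add_ncard {f ∈ F | tail f ∉ X ∧ head f ∈ X} {e}
  rw [Set.ncard_singleton] at h
  refine h.trans (Nat.add_le_add_right (Set.ncard_le_ncard ?_ (Set.toFinite _)) 1)
  rintro f ⟨⟨h1, h2⟩, h3⟩
  exact ⟨⟨h1, h3⟩, h2⟩

theorem exists_edge_of_rho_lt {α E : Type*} [Fintype E] {tail head : E → α} {F : Set E}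
    {X Y : Set α} (h : rho tail head F X < rho tail head F Y) :
    ∃ e ∈ F, tail e ∉ Y ∧ head e ∈ Y ∧ ¬ (tail e ∉ X ∧ head e ∈ X) := by
  by_contra! hcon
  exact h.not_ge (rho_le_rho fun e he h1 h2 => ⟨he, hcon e he h1 h2⟩)

theorem exists_edge_of_rho_pos {α E : Type*} [Fintype E] {tail head : E → α} {F : Set E}
    {X : Set α} (h : 0 < rho tail head F X) : ∃ e ∈ F, tail e ∉ X ∧ head e ∈ X := by
  obtain ⟨e, h1, h2⟩ := Set.nonempty_of_ncard_ne_zero h.ne'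
  exact ⟨e, h1, h2⟩

/-! ### Menger's theorem -/

/-- Every edge set that can carry a walk from `u` to `v ≠ u` carries a path. -/
theorem exists_path_of_reflTransGen {α E : Type*} {tail head : E → α} {Q : Set E} {u v : α}
    (h : Relation.ReflTransGen (fun a b => ∃ e ∈ Q, tail e = a ∧ head e = b) u v) :
    u = v ∨ ∃ p, IsRVPath tail head Q u v p := by
  induction h using Relation.ReflTransGen.head_induction_on with
  | refl => exact Or.inl rfl
  | @head u w huw _ ih =>
    obtain ⟨e, heQ, rfl, rfl⟩ := huw
    by_cases huv : tail e = v
    · exact Or.inl huv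
    right
    rcases ih with rfl | ⟨p, h1, h2, h3, h4, ⟨a, h5, h5'⟩, b, h6, h6'⟩
    · exact ⟨[e], by simpa using heQ, List.isChain_singleton e, by simp, by simpa using huv,
        ⟨e, by simp⟩, ⟨e, by simp⟩⟩
    by_cases hu : ∃ f ∈ p, tail f = tail e
    · obtain ⟨f, hf, hfe⟩ := hu
      obtain ⟨l₁, l₂, rfl⟩ := List.append_of_mem hf
      refine ⟨f :: l₂, fun x hx => h1 x (List.mem_append_right _ hx), ?_, ?_,
        fun x hx => h4 x (List.mem_append_right _ hx), ⟨f, rfl, hfe⟩, b, ?_, h6'⟩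
      · exact List.IsChain.right_of_append h2
      · rw [List.map_append] at h3
        exact h3.of_append_right
      · simpa [List.getLast?_append] using h6
    · push Not at hu
      obtain ⟨l, rfl⟩ : ∃ l, p = a :: l := by
        cases p with
        | nil => simp at h5
        | cons x l => exact ⟨l, by simpa using h5⟩
      refine ⟨e :: a :: l, ?_, ?_, ?_, ?_, ⟨e, rfl, rfl⟩, b, ?_, h6'⟩
      · simpa [heQ] using h1
      · exact List.IsChain.cons_cons h5'.symm h2
      · rw [List.map_cons, List.nodup_cons]
        refine ⟨fun h => ?_, h3⟩
        obtain ⟨f, hf, hfe⟩ := List.mem_map.1 h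
        exact hu f hf hfe
      · simpa [huv] using h4
      · simpa using h6

/-- If every cut separating `r` from `v` has at least `n + 1` edges of `F`, counting a virtual edge
from `r` to `u`, then the edges of a walk from `u` or `r` to `v` can be deleted such that at least
`n` edges remain in every cut. -/
theorem exists_walk_deletion {α E : Type*} [Fintype α] [Fintype E] {tail head : E → α}
    {r v : α} (hrv : r ≠ v) (n k : ℕ) : ∀ (F : Set E) (u : α), F.ncard = k →
    (∀ X : Set α, r ∉ X → v ∈ X → u ∉ X → n + 1 ≤ rho tail head F X) →
    (∀ X : Set α, r ∉ X → v ∈ X → n ≤ rho tail head F X) →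
    ∃ Q ⊆ F, (∃ s, (s = u ∨ s = r) ∧
        Relation.ReflTransGen (fun a b => ∃ e ∈ Q, tail e = a ∧ head e = b) s v) ∧
      ∀ X : Set α, r ∉ X → v ∈ X → n ≤ rho tail head (F \ Q) X := by
  induction k with
  | zero =>
    intro F u hF h1 _
    have hF : F = ∅ := (Set.ncard_eq_zero (Set.toFinite _)).1 hF
    by_cases huv : u = v
    · exact ⟨∅, Set.empty_subset _, ⟨v, Or.inl huv.symm, .refl⟩, by simpa⟩
    · have := h1 {v} hrv rfl huv
      simp [rho, hF] at this
  | succ k ih =>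
    intro F u hF h1 h2
    by_cases huv : u = v
    · exact ⟨∅, Set.empty_subset _, ⟨v, Or.inl huv.symm, .refl⟩, by simpa⟩
    have key : ∃ e ∈ F, (tail e = u ∨ tail e = r) ∧ ∀ X : Set α, r ∉ X → v ∈ X →
        (head e ∉ X ∨ tail e ∉ X) → n + 1 ≤ rho tail head F X := by
      by_cases ht : ∃ X : Set α, r ∉ X ∧ v ∈ X ∧ u ∈ X ∧ rho tail head F X = n
      · obtain ⟨X, hX⟩ := exists_minimal_of_wellFoundedLT _ ht
        obtain ⟨hrX, hvX, huX, hX'⟩ := hX.prop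
        have hlt : rho tail head F X < rho tail head F (X \ {u}) := by
          have := h1 (X \ {u}) (fun h => hrX h.1) ⟨hvX, fun h => huv h.symm⟩ (fun h => h.2 rfl)
          omega
        obtain ⟨e, heF, ha, hb, hc⟩ := exists_edge_of_rho_lt hlt
        have hte : tail e = u := by
          by_contra hne
          exact hc ⟨fun h => ha ⟨h, hne⟩, hb.1⟩
        refine ⟨e, heF, Or.inl hte, fun Y hrY hvY hY => ?_⟩
        rw [hte] at hY
        by_cases huY : u ∈ Y
        swap
        · exact h1 Y hrY hvY huY
        by_contra hlt
        have hsub := rho_inter_add_union_le tail head F X Y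
        have hi := h2 (X ∩ Y) (fun h => hrX h.1) ⟨hvX, hvY⟩
        have hun := h2 (X ∪ Y) (fun h => h.elim hrX hrY) (Or.inl hvX)
        have := hX.le_of_le (y := X ∩ Y)
          ⟨fun h => hrX h.1, ⟨hvX, hvY⟩, ⟨huX, huY⟩, by omega⟩ Set.inter_subset_left
        exact hY.elim (fun h => h (this hb.1).2) (fun h => h huY)
      · have hall : ∀ X : Set α, r ∉ X → v ∈ X → n + 1 ≤ rho tail head F X := by
          intro X hrX hvX
          by_cases huX : u ∈ X
          · exact (h2 X hrX hvX).lt_of_ne fun h => ht ⟨X, hrX, hvX, huX, h.symm⟩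
          · exact h1 X hrX hvX huX
        have hpos : 0 < rho tail head F {r}ᶜ :=
          (Nat.succ_pos n).trans_le (hall _ (by simp) (by simpa using hrv.symm))
        obtain ⟨e, heF, ha, _⟩ := exists_edge_of_rho_pos hpos
        exact ⟨e, heF, Or.inr (by simpa using ha), fun X hrX hvX _ => hall X hrX hvX⟩
    obtain ⟨e, heF, hte, he⟩ := key
    have hsame : ∀ X : Set α, (head e ∉ X ∨ tail e ∈ X) →
        rho tail head F X ≤ rho tail head (F \ {e}) X := fun X hX =>
      rho_le_rho fun f hf ha hb => ⟨⟨hf, by rintro rfl; tauto⟩, ha, hb⟩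
    obtain ⟨Q, hQF, ⟨s, hs, hsv⟩, hQ⟩ := ih (F \ {e}) (head e)
      (by rw [Set.ncard_sdiff_singleton_of_mem heF]; omega)
      (fun X hrX hvX hX => (he X hrX hvX (Or.inl hX)).trans (hsame X (Or.inl hX)))
      (fun X hrX hvX => by
        by_cases htX : tail e ∈ X
        · exact (h2 X hrX hvX).trans (hsame X (Or.inr htX))
        · have := he X hrX hvX (Or.inr htX)
          have := rho_le_rho_diff_singleton_add_one tail head F X e
          omega)
    rcases hs with rfl | rfl
    · refine ⟨insert e Q, Set.insert_subset heF (hQF.trans Set.sdiff_subset),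
        ⟨tail e, hte, .head ⟨e, Set.mem_insert _ _, rfl, rfl⟩ (Relation.ReflTransGen.mono ?_ _ _ hsv)⟩,
        fun X hrX hvX => ?_⟩
      · rintro a b ⟨f, hf, hab⟩
        exact ⟨f, Set.mem_insert_of_mem _ hf, hab⟩
      · have := hQ X hrX hvX
        rwa [Set.sdiff_sdiff, Set.singleton_union] at this
    · refine ⟨Q, hQF.trans Set.sdiff_subset, ⟨s, Or.inr rfl, hsv⟩, fun X hrX hvX => ?_⟩
      exact (hQ X hrX hvX).trans
        (rho_le_rho fun f hf ha hb => ⟨⟨hf.1.1, hf.2⟩, ha, hb⟩)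

theorem IsRVPath.mono {α E : Type*} {tail head : E → α} {F G : Set E} {r v : α} {p : List E}
    (hp : IsRVPath tail head F r v p) (h : F ⊆ G) : IsRVPath tail head G r v p :=
  ⟨fun e he => h (hp.1 e he), hp.2⟩

/-- Menger's theorem, directed edge version. -/
theorem hasEDPaths_of_le_rho {α E : Type*} [Fintype α] [Fintype E] {tail head : E → α}
    {r v : α} (hrv : r ≠ v) (n : ℕ) : ∀ F : Set E,
    (∀ X : Set α, r ∉ X → v ∈ X → n ≤ rho tail head F X) → HasEDPaths tail head F r v n := by
  induction n with
  | zero => exact fun F _ => ⟨Fin.elim0, fun i => i.elim0, fun i => i.elim0⟩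
  | succ n ih =>
    intro F h
    obtain ⟨Q, hQF, ⟨s, hs, hsv⟩, hQ⟩ := exists_walk_deletion hrv n _ F r rfl
      (fun X hrX hvX _ => h X hrX hvX) (fun X hrX hvX => (Nat.le_succ n).trans (h X hrX hvX))
    obtain rfl : s = r := by tauto
    obtain ⟨p, hp⟩ := (exists_path_of_reflTransGen hsv).resolve_left hrv
    obtain ⟨P, hP, hdisj⟩ := ih (F \ Q) hQ
    refine ⟨Fin.cons p P, fun i => ?_, fun i j hij e hi hj => ?_⟩
    · cases i using Fin.cases with
      | zero => exact hp.mono hQF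
      | succ i => exact (hP i).mono Set.sdiff_subset
    · cases i using Fin.cases <;> cases j using Fin.cases
      · exact hij rfl
      · exact ((hP _).1 e hj).2 (hp.1 e hi)
      · exact ((hP _).1 e hi).2 (hp.1 e hj)
      · exact hdisj _ _ (fun h => hij (congrArg _ h)) e hi hj

theorem IsRVPath.exists_mem_entering {α E : Type*} {tail head : E → α} {F : Set E} {v : α}
    {X : Set α} (hv : v ∈ X) {p : List E} : ∀ {u : α}, u ∉ X → IsRVPath tail head F u v p →
    ∃ e ∈ p, tail e ∉ X ∧ head e ∈ X := by
  induction p with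
  | nil => rintro u - ⟨-, -, -, -, ⟨e, h, -⟩, -⟩; simp at h
  | cons a l ih =>
    rintro u hu ⟨h1, h2, h3, h4, ⟨b, h5, rfl⟩, c, h6, rfl⟩
    obtain rfl : a = b := by simpa using h5
    by_cases ha : head a ∈ X
    · exact ⟨a, List.mem_cons_self, hu, ha⟩
    cases l with
    | nil =>
      obtain rfl : a = c := by simpa using h6
      exact absurd hv ha
    | cons d l =>
      obtain ⟨h2a, h2b⟩ := List.isChain_cons_cons.1 h2
      obtain ⟨e, he, hX⟩ := ih (u := head a) ha ⟨fun e he => h1 e (List.mem_cons_of_mem _ he),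
        h2b, (List.nodup_cons.1 h3).2, fun e he => h4 e (List.mem_cons_of_mem _ he),
        ⟨d, rfl, h2a.symm⟩, c, by simpa using h6, rfl⟩
      exact ⟨e, List.mem_cons_of_mem _ he, hX⟩

theorem HasEDPaths.le_rho {α E : Type*} [Fintype E] {tail head : E → α} {F : Set E}
    {r v : α} {n : ℕ} (h : HasEDPaths tail head F r v n) {X : Set α} (hr : r ∉ X) (hv : v ∈ X) :
    n ≤ rho tail head F X := by
  obtain ⟨P, hP, hdisj⟩ := h
  choose f hf hfX using fun i => (hP i).exists_mem_entering hv hr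
  have hinj : Function.Injective f := fun i j hij => by
    by_contra hne
    exact hdisj i j hne (f i) (hf i) (hij ▸ hf j)
  have hsub : Set.range f ⊆ {e ∈ F | tail e ∉ X ∧ head e ∈ X} := by
    rintro _ ⟨i, rfl⟩
    exact ⟨(hP i).1 _ (hf i), hfX i⟩
  have := Set.ncard_le_ncard hsub (Set.toFinite _)
  rwa [← Set.image_univ, Set.ncard_image_of_injective _ hinj, Set.ncard_univ, Nat.card_fin] at this

theorem rho_singleton_le_inDeg {α E : Type*} [Fintype E] (tail head : E → α) (F : Set E)
    (v : α) : rho tail head F {v} ≤ inDeg head F v :=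
  Set.ncard_le_ncard (fun _ he => ⟨he.1, he.2.2⟩) (Set.toFinite _)

/-- A digraph is a flame exactly if no vertex set avoiding the root has fewer entering edges than
the in-degree of one of its members. -/
theorem isFlame_iff {α E : Type*} [Fintype α] [Fintype E] {tail head : E → α} {F : Set E}
    {r : α} : IsFlame tail head F r ↔
      ∀ (X : Set α) (v : α), r ∉ X → v ∈ X → inDeg head F v ≤ rho tail head F X := by
  have hbdd : ∀ v, v ≠ r → BddAbove {n | HasEDPaths tail head F r v n} := fun v hv =>
    ⟨_, fun n hn => HasEDPaths.le_rho (X := {v}) hn (Ne.symm hv) rfl⟩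
  have hne : ∀ v, {n | HasEDPaths tail head F r v n}.Nonempty := fun v =>
    ⟨0, Fin.elim0, fun i => i.elim0, fun i => i.elim0⟩
  constructor
  · intro h X v hr hv
    have hvr : v ≠ r := by rintro rfl; exact hr hv
    rw [← h v hvr]
    exact HasEDPaths.le_rho (Nat.sSup_mem (hne v) (hbdd v hvr)) hr hv
  · intro h v hv
    apply le_antisymm
    · exact (HasEDPaths.le_rho (X := {v}) (Nat.sSup_mem (hne v) (hbdd v hv)) (Ne.symm hv)
        rfl).trans (rho_singleton_le_inDeg _ _ _ _)
    · exact le_csSup (hbdd v hv) (hasEDPaths_of_le_rho hv.symm _ F fun X hr hX => h X v hr hX)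

/-! ### Splitting off one branching -/

theorem IsDicycle.exists_next {α E : Type*} {tail head : E → α} {F : Set E} {p : List E}
    (hp : IsDicycle tail head F p) {e : E} (he : e ∈ p) : ∃ f ∈ p, tail f = head e := by
  obtain ⟨-, -, hc, a, b, ha, hb, hab⟩ := hp
  obtain ⟨l₁, l₂, rfl⟩ := List.append_of_mem he
  cases l₂ with
  | nil =>
    obtain rfl : e = b := by simpa using hb
    exact ⟨a, List.mem_of_mem_head? ha, hab.symm⟩
  | cons f l =>
    refine ⟨f, by simp, ?_⟩
    exact (List.isChain_cons_cons.1 (List.IsChain.right_of_append hc)).1.symm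

theorem not_isDicycle_insert {α E : Type*} {tail head : E → α} {B : Set E} {e : E}
    (hB : ∀ p, ¬ IsDicycle tail head B p) (he : ∀ f ∈ insert e B, tail f ≠ head e) (p : List E) :
    ¬ IsDicycle tail head (insert e B) p := by
  intro hp
  by_cases hep : e ∈ p
  · obtain ⟨f, hf, hfe⟩ := hp.exists_next hep
    exact he f (hp.2.1 f hf) hfe
  · refine hB p ⟨hp.1, fun f hf => ?_, hp.2.2⟩
    exact (hp.2.1 f hf).resolve_left (fun h => hep (h ▸ hf))

/-- If every set avoiding `r` and meeting `U` is entered by more than `m` edges, then some acyclic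
edge set that enters each vertex outside `S` of `U` exactly once can be deleted such that these
sets are still entered by at least `m` edges. -/
theorem exists_partial_branching {α E : Type*} [Fintype α] [Fintype E] {tail head : E → α}
    {r : α} {F : Set E} {U : Set α} {m : ℕ}
    (hF : ∀ X : Set α, r ∉ X → (X ∩ U).Nonempty → m + 1 ≤ rho tail head F X) (hrU : r ∉ U)
    (k : ℕ) : k ≤ U.ncard → ∃ S ⊆ U, S.ncard + k = U.ncard ∧ ∃ B ⊆ F,
      (∀ p, ¬ IsDicycle tail head B p) ∧ Set.InjOn head B ∧ head '' B = U \ S ∧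
      (∀ e ∈ B, tail e ∉ S) ∧
      ∀ X : Set α, r ∉ X → (X ∩ U).Nonempty → m ≤ rho tail head (F \ B) X := by
  induction k with
  | zero =>
    intro _
    refine ⟨U, subset_rfl, rfl, ∅, Set.empty_subset _, ?_, by simp, by simp, by simp, ?_⟩
    · rintro p ⟨-, h, -, e, -, he, -⟩
      exact h e (List.mem_of_mem_head? he)
    · intro X hr hX
      have := hF X hr hX
      rw [Set.sdiff_empty]
      omega
  | succ k ih =>
    intro hk
    obtain ⟨S, hSU, hS, B, hBF, hcyc, hinj, hhead, htail, hcut⟩ := ih (by omega)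
    have hSne : S.Nonempty := Set.nonempty_of_ncard_ne_zero (by omega)
    have hlarge : ∀ X ⊆ S, X.Nonempty → m + 1 ≤ rho tail head (F \ B) X := by
      intro X hXS hX
      refine (hF X (fun h => hrU (hSU (hXS h)))
        (hX.mono fun x hx => ⟨hx, hSU (hXS hx)⟩)).trans (rho_le_rho fun e he ha hb => ?_)
      refine ⟨⟨he, fun heB => ?_⟩, ha, hb⟩
      have : head e ∈ U \ S := hhead ▸ Set.mem_image_of_mem head heB
      exact this.2 (hXS hb)
    have key : ∃ e ∈ F \ B, tail e ∉ S ∧ head e ∈ S ∧ ∀ X : Set α, r ∉ X → tail e ∉ X →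
        head e ∈ X → m + 1 ≤ rho tail head (F \ B) X := by
      by_cases ht : ∃ X : Set α, r ∉ X ∧ (X ∩ S).Nonempty ∧ rho tail head (F \ B) X = m
      · obtain ⟨X, hX⟩ := exists_minimal_of_wellFoundedLT _ ht
        obtain ⟨hrX, hXS, hX'⟩ := hX.prop
        have hlt : rho tail head (F \ B) X < rho tail head (F \ B) (X ∩ S) := by
          have := hlarge (X ∩ S) Set.inter_subset_right hXS
          omega
        obtain ⟨e, heF, ha, hb, hc⟩ := exists_edge_of_rho_lt hlt
        have htX : tail e ∈ X := by
          by_contra h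
          exact hc ⟨h, hb.1⟩
        refine ⟨e, heF, fun h => ha ⟨htX, h⟩, hb.2, fun Y hrY htY hhY => ?_⟩
        by_contra hlt
        have hsub := rho_inter_add_union_le tail head (F \ B) X Y
        have hi := hcut (X ∩ Y) (fun h => hrX h.1) ⟨_, ⟨hb.1, hhY⟩, hSU hb.2⟩
        have hun := hcut (X ∪ Y) (fun h => h.elim hrX hrY) ⟨_, Or.inl hb.1, hSU hb.2⟩
        have := hX.le_of_le (y := X ∩ Y)
          ⟨fun h => hrX h.1, ⟨_, ⟨hb.1, hhY⟩, hb.2⟩, by omega⟩ Set.inter_subset_left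
        exact htY (this htX).2
      · obtain ⟨e, heF, ha, hb⟩ := exists_edge_of_rho_pos
          ((Nat.succ_pos m).trans_le (hlarge S subset_rfl hSne))
        refine ⟨e, heF, ha, hb, fun X hrX _ hX => ?_⟩
        exact (hcut X hrX ⟨_, hX, hSU hb⟩).lt_of_ne fun h => ht ⟨X, hrX, ⟨_, hX, hb⟩, h.symm⟩
    obtain ⟨e, heF, hte, hhe, he⟩ := key
    have hnew : head e ∉ head '' B := fun h => (hhead ▸ h : head e ∈ U \ S).2 hhe
    refine ⟨S \ {head e}, Set.sdiff_subset.trans hSU, ?_, insert e B,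
      Set.insert_subset heF.1 hBF, not_isDicycle_insert hcyc ?_, ?_, ?_, ?_, ?_⟩
    · have := Set.ncard_sdiff_singleton_add_one hhe (Set.toFinite _)
      omega
    · rintro f (rfl | hf) h
      · exact hte (h ▸ hhe)
      · exact htail f hf (h ▸ hhe)
    · exact (Set.injOn_insert heF.2).2 ⟨hinj, hnew⟩
    · rw [Set.image_insert_eq, hhead]
      ext x
      by_cases hx : x = head e
      · simp [hx, hSU hhe]
      · simp [hx]
    · rintro f (rfl | hf) h
      · exact hte h.1
      · exact htail f hf h.1
    · intro X hrX hX
      have hdiff : F \ insert e B = (F \ B) \ {e} := by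
        rw [Set.sdiff_sdiff, Set.union_singleton]
      rw [hdiff]
      by_cases hent : tail e ∉ X ∧ head e ∈ X
      · have := he X hrX hent.1 hent.2
        have := rho_le_rho_diff_singleton_add_one tail head (F \ B) X e
        omega
      · refine (hcut X hrX hX).trans (rho_le_rho fun f hf ha hb => ⟨⟨hf, ?_⟩, ha, hb⟩)
        rintro rfl
        exact hent ⟨ha, hb⟩

theorem inDeg_diff_add {α E : Type*} [Fintype E] (head : E → α) {F B : Set E} (h : B ⊆ F)
    (v : α) : inDeg head (F \ B) v + inDeg head B v = inDeg head F v := by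
  unfold inDeg
  have h1 : {e ∈ B | head e = v} ⊆ {e ∈ F | head e = v} := fun e he => ⟨h he.1, he.2⟩
  rw [← Set.ncard_sdiff_add_ncard_of_subset h1 (Set.toFinite _)]
  congr 2
  ext e
  simp only [Set.mem_sdiff, Set.mem_ofPred_eq]
  tauto

theorem inDeg_eq_zero_iff {α E : Type*} [Fintype E] {head : E → α} {F : Set E} {v : α} :
    inDeg head F v = 0 ↔ v ∉ head '' F := by
  rw [inDeg, Set.ncard_eq_zero (Set.toFinite _), Set.eq_empty_iff_forall_notMem]
  simp

theorem inDeg_le_one_of_injOn {α E : Type*} [Fintype E] {head : E → α} {B : Set E}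
    (h : Set.InjOn head B) (v : α) : inDeg head B v ≤ 1 :=
  (Set.ncard_le_one (Set.toFinite _)).2 fun _ ha _ hb => h ha.1 hb.1 (ha.2.trans hb.2.symm)

/-- A flame of maximum in-degree at most `m` has an edge coloring with colors `0, …, m - 1` whose
color classes are branchings, the `i`-th one entering exactly the vertices of in-degree more than
`i`, and whose initial unions of color classes are flames. -/
theorem exists_branching_coloring {α E : Type*} [Fintype α] [Fintype E] {tail head : E → α}
    {r : α} (m : ℕ) : ∀ F : Set E, IsFlame tail head F r → inDeg head F r = 0 →
    (∀ v, inDeg head F v ≤ m) → ∃ c : E → ℕ, (∀ e ∈ F, c e < m) ∧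
      (∀ i < m, IsBranching tail head {e ∈ F | c e = i}) ∧
      (∀ i < m, headSet head {e ∈ F | c e = i} = {v | i + 1 ≤ inDeg head F v}) ∧
      ∀ i, IsFlame tail head {e ∈ F | c e ≤ i} r := by
  induction m with
  | zero =>
    intro F hF _ hle
    have hF0 : F = ∅ := by
      rw [Set.eq_empty_iff_forall_notMem]
      intro e he
      exact inDeg_eq_zero_iff.1 (Nat.le_zero.1 (hle (head e))) ⟨e, he, rfl⟩
    subst hF0
    exact ⟨fun _ => 0, by simp, by simp, by simp, by simpa using hF⟩
  | succ m ih =>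
    intro F hF hr hle
    have hF' := isFlame_iff.1 hF
    set U : Set α := {v | inDeg head F v = m + 1} with hU
    have hrU : r ∉ U := by simp [hU, hr]
    obtain ⟨S, -, hS, B, hBF, hcyc, hinj, hhead, -, hcut⟩ := exists_partial_branching (F := F)
      (U := U) (m := m) (fun X hrX ⟨v, hvX, hvU⟩ => hvU ▸ hF' X v hrX hvX) hrU _ le_rfl
    obtain rfl : S = ∅ := (Set.ncard_eq_zero (Set.toFinite _)).1 (by omega)
    rw [Set.sdiff_empty] at hhead
    have hBdeg : ∀ v, (v ∈ U ∧ inDeg head B v = 1) ∨ (v ∉ U ∧ inDeg head B v = 0) := by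
      intro v
      have h1 := inDeg_le_one_of_injOn hinj v
      have h0 := inDeg_eq_zero_iff (head := head) (F := B) (v := v)
      rw [hhead] at h0
      by_cases hv : v ∈ U
      · exact Or.inl ⟨hv, by have := mt h0.1 (not_not.2 hv); omega⟩
      · exact Or.inr ⟨hv, h0.2 hv⟩
    have hdeg : ∀ v, inDeg head (F \ B) v = min m (inDeg head F v) := by
      intro v
      have h1 := inDeg_diff_add head hBF v
      have h2 := hle v
      rcases hBdeg v with ⟨hv, h⟩ | ⟨hv, h⟩ <;> simp only [hU, Set.mem_ofPred_eq] at hv <;> omega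
    have hflame : IsFlame tail head (F \ B) r := by
      rw [isFlame_iff]
      intro X v hrX hvX
      rw [hdeg]
      by_cases hX : (X ∩ U).Nonempty
      · exact (min_le_left _ _).trans (hcut X hrX hX)
      · refine (min_le_right _ _).trans ((hF' X v hrX hvX).trans
          (rho_le_rho fun e he ha hb => ⟨⟨he, fun heB => hX ⟨head e, hb, ?_⟩⟩, ha, hb⟩))
        exact hhead ▸ Set.mem_image_of_mem head heB
    obtain ⟨c, hc, hbr, hhs, hfl⟩ := ih (F \ B) hflame (by rw [hdeg, hr]; simp)
      (fun v => by rw [hdeg]; exact min_le_left _ _)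
    classical
    have hlast : {e ∈ F | (if e ∈ B then m else c e) = m} = B := by
      ext e
      by_cases he : e ∈ B
      · simp [he, hBF he]
      · have := hc e
        simp only [Set.mem_ofPred_eq, he, if_false, iff_false]
        rintro ⟨heF, h⟩
        exact (this ⟨heF, he⟩).ne h
    have hlow : ∀ i < m,
        {e ∈ F | (if e ∈ B then m else c e) = i} = {e ∈ F \ B | c e = i} := by
      intro i hi
      ext e
      by_cases he : e ∈ B <;> simp [he, hi.ne']
    refine ⟨fun e => if e ∈ B then m else c e, fun e he => ?_, fun i hi => ?_, fun i hi => ?_,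
      fun i => ?_⟩
    · by_cases heB : e ∈ B
      · simp [heB]
      · simpa [heB] using (hc e ⟨he, heB⟩).trans (Nat.lt_succ_self m)
    · rcases (Nat.lt_succ_iff_lt_or_eq.1 hi) with hi | rfl
      · rw [hlow i hi]
        exact hbr i hi
      · rw [hlast]
        exact ⟨inDeg_le_one_of_injOn hinj, hcyc⟩
    · rcases (Nat.lt_succ_iff_lt_or_eq.1 hi) with hi | rfl
      · rw [hlow i hi, hhs i hi]
        ext v
        simp only [Set.mem_ofPred_eq, hdeg]
        omega
      · rw [hlast]
        refine hhead.trans ?_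
        ext v
        have := hle v
        simp only [hU, Set.mem_ofPred_eq]
        omega
    · rcases lt_or_ge i m with hi | hi
      · convert hfl i using 1
        ext e
        by_cases he : e ∈ B <;> simp [he, hi]
      · convert hF using 1
        ext e
        by_cases he : e ∈ B
        · simp [he, hi, hBF he]
        · simp only [Set.mem_ofPred_eq, he, if_false, and_iff_left_iff_imp]
          exact fun heF => (hc e ⟨heF, he⟩).le.trans hi

/-- a flame `F` with `ϱ_F(r) = 0`, `m = max_{v ∈ V} ϱ_F(v) ≥ 1`
and `V_i = {v ∈ V : ϱ_F(v) ≥ i}` can be partitioned into pairwise disjoint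
branchings `B₁, …, B_m` (here `B i` for `i : Fin m` plays the role of
`B_{i+1}`) such that the head-set of `B_i` is `V_i` and `B₁ ∪ … ∪ B_i` is a
flame for every `i = 1, …, m`. -/
theorem flame_decomposition_into_branchings
    {α E : Type*} [Fintype α] [Fintype E] (tail head : E → α) (r : α)
    (hflame : IsFlame tail head Set.univ r)
    (hr : inDeg head Set.univ r = 0)
    (m : ℕ) (hm : 1 ≤ m)
    (hub : ∀ v, v ≠ r → inDeg head Set.univ v ≤ m)
    (hex : ∃ v, v ≠ r ∧ inDeg head Set.univ v = m) :
    ∃ B : Fin m → Set E,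
      (∀ i, IsBranching tail head (B i)) ∧
      (∀ i j, i ≠ j → Disjoint (B i) (B j)) ∧
      (⋃ i, B i) = Set.univ ∧
      (∀ i, headSet head (B i)
        = {v | v ≠ r ∧ (i : ℕ) + 1 ≤ inDeg head Set.univ v}) ∧
      (∀ i : Fin m, IsFlame tail head (⋃ j ∈ Set.Iic i, B j) r) := by
  have hle : ∀ v, inDeg head Set.univ v ≤ m := by
    intro v
    by_cases hv : v = r
    · rw [hv, hr]
      exact Nat.zero_le m
    · exact hub v hv
  obtain ⟨c, hc, hbr, hhs, hfl⟩ := exists_branching_coloring m Set.univ hflame hr hle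
  refine ⟨fun i => {e ∈ Set.univ | c e = i}, fun i => hbr i i.2, fun i j hij => ?_, ?_,
    fun i => ?_, fun i => ?_⟩
  · rw [Set.disjoint_left]
    rintro e ⟨-, hi⟩ ⟨-, hj⟩
    exact hij (Fin.ext (hi.symm.trans hj))
  · exact Set.eq_univ_of_forall fun e => Set.mem_iUnion.2 ⟨⟨c e, hc e trivial⟩, trivial, rfl⟩
  · rw [hhs i i.2]
    ext v
    simp only [Set.mem_ofPred_eq]
    refine ⟨fun h => ⟨?_, h⟩, fun h => h.2⟩
    rintro rfl
    omega
  · convert hfl i using 1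
    ext e
    simp only [Set.mem_iUnion, Set.mem_Iic, Set.mem_ofPred_eq, Set.mem_univ, true_and, exists_prop]
    constructor
    · rintro ⟨j, hj, he⟩
      exact he ▸ hj
    · intro h
      exact ⟨⟨c e, hc e trivial⟩, h, rfl⟩
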